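/- There exists a finitely axiomatized normal strictly positive logic L (over a finite modal signature) such that the set of provable sequents {(A, B) : A ⊢_L B} is undecidable. -/

import Mathlib

/-- Strictly positive formulas over signature `α` and variables `V`. -/
inductive SPF (α V : Type) : Type
  | var : V → SPF α V
  | top : SPF α V
  | and : SPF α V → SPF α V → SPF α V
  | dia : α → SPF α V → SPF α V
  deriving DecidableEq

namespace SPF

/-- Simultaneous substitution. -/
def subst {α V : Type} (σ : V → SPF α V) : SPF α V → SPF α V
  | var v => σ v
  | top => top
  | and A B => and (A.subst σ) (B.subst σ)
  | dia a A => dia a (A.subst σ)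

/-- `C.substVar p A` is `C[A/p]`: replace all occurrences of variable `p` in `C` by `A`. -/
def substVar {α V : Type} [DecidableEq V] (C : SPF α V) (p : V) (A : SPF α V) : SPF α V :=
  C.subst (fun v => if v = p then A else var v)

/-- `⊤` does not occur. -/
def noTop {α V : Type} : SPF α V → Prop
  | var _ => True
  | top => False
  | and A B => noTop A ∧ noTop B
  | dia _ A => noTop A

/-- Contains at least one conjunction. -/
def hasAnd {α V : Type} : SPF α V → Prop
  | var _ => False
  | top => False
  | and _ _ => True
  | dia _ A => hasAnd A

end SPF

/-- A word `W ∈ Σ*` applied to a formula as a sequence of diamonds. -/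
def wApp {α V : Type} (W : List α) (F : SPF α V) : SPF α V :=
  W.foldr (fun a G => SPF.dia a G) F

/-- Sequent calculus over `K⁺` with extra axiom set `Ax`.  `Der ∅` is exactly `K⁺`. -/
inductive Der {α V : Type} (Ax : Set (SPF α V × SPF α V)) : SPF α V → SPF α V → Prop
  | id (A) : Der Ax A A
  | top (A) : Der Ax A SPF.top
  | cut {A B C} : Der Ax A B → Der Ax B C → Der Ax A C
  | andE1 (A B) : Der Ax (SPF.and A B) A
  | andE2 (A B) : Der Ax (SPF.and A B) B
  | andI {A B C} : Der Ax A B → Der Ax A C → Der Ax A (SPF.and B C)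
  | mono (a) {A B} : Der Ax A B → Der Ax (SPF.dia a A) (SPF.dia a B)
  | ax {A B} : (A, B) ∈ Ax → Der Ax A B

/-- Normal strictly positive logic: a set of sequents containing `K⁺`,
closed under its rules and under substitution. -/
structure SPNormal {α V : Type} (P : Set (SPF α V × SPF α V)) : Prop where
  kp : ∀ A B : SPF α V, Der ∅ A B → (A, B) ∈ P
  cut : ∀ A B C : SPF α V, (A, B) ∈ P → (B, C) ∈ P → (A, C) ∈ P
  andI : ∀ A B C : SPF α V, (A, B) ∈ P → (A, C) ∈ P → (A, SPF.and B C) ∈ P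
  mono : ∀ (a : α) (A B : SPF α V), (A, B) ∈ P → (SPF.dia a A, SPF.dia a B) ∈ P
  substC : ∀ (σ : V → SPF α V) (A B : SPF α V), (A, B) ∈ P → (A.subst σ, B.subst σ) ∈ P

/-- Modal formulas. -/
inductive MF (α V : Type) : Type
  | var : V → MF α V
  | bot : MF α V
  | imp : MF α V → MF α V → MF α V
  | dia : α → MF α V → MF α V

namespace MF

def neg {α V : Type} (A : MF α V) : MF α V := imp A bot
def box {α V : Type} (a : α) (A : MF α V) : MF α V := neg (dia a (neg A))
def mand {α V : Type} (A B : MF α V) : MF α V := neg (imp A (neg B))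

def subst {α V : Type} (σ : V → MF α V) : MF α V → MF α V
  | var v => σ v
  | bot => bot
  | imp A B => imp (A.subst σ) (B.subst σ)
  | dia a A => dia a (A.subst σ)

end MF

/-- Normal modal logic (Hilbert-style closure conditions). -/
structure MNormal {α V : Type} (L : Set (MF α V)) : Prop where
  k1 : ∀ A B : MF α V, MF.imp A (MF.imp B A) ∈ L
  k2 : ∀ A B C : MF α V,
    MF.imp (MF.imp A (MF.imp B C)) (MF.imp (MF.imp A B) (MF.imp A C)) ∈ L
  dne : ∀ A : MF α V, MF.imp (MF.neg (MF.neg A)) A ∈ L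
  kax : ∀ (a : α) (A B : MF α V),
    MF.imp (MF.box a (MF.imp A B)) (MF.imp (MF.box a A) (MF.box a B)) ∈ L
  mp : ∀ A B : MF α V, MF.imp A B ∈ L → A ∈ L → B ∈ L
  nec : ∀ (a : α) (A : MF α V), A ∈ L → MF.box a A ∈ L
  substC : ∀ (σ : V → MF α V) (A : MF α V), A ∈ L → A.subst σ ∈ L

/-- Translation of strictly positive formulas into modal formulas. -/
def toMF {α V : Type} : SPF α V → MF α V
  | SPF.var v => MF.var v
  | SPF.top => MF.neg MF.bot
  | SPF.and A B => MF.mand (toMF A) (toMF B)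
  | SPF.dia a A => MF.dia a (toMF A)

/-- `𝒫(L)`: the strictly positive fragment of a modal logic `L`. -/
def Pfrag {α V : Type} (L : Set (MF α V)) : Set (SPF α V × SPF α V) :=
  {x | MF.imp (toMF x.1) (toMF x.2) ∈ L}

/-- `ℳ(P)`: the least normal modal logic containing all implications `A → B`
for sequents `(A, B) ∈ P`. -/
def Mop {α V : Type} (P : Set (SPF α V × SPF α V)) : Set (MF α V) :=
  ⋂₀ {L | MNormal L ∧ ∀ x ∈ P, MF.imp (toMF x.1) (toMF x.2) ∈ L}

/-- Contexts: strictly positive formulas with exactly one occurrence of a hole. -/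
inductive Ctx (α V : Type) : Type
  | hole : Ctx α V
  | andL : Ctx α V → SPF α V → Ctx α V
  | andR : SPF α V → Ctx α V → Ctx α V
  | dia : α → Ctx α V → Ctx α V

/-- Plugging a formula into a context. -/
def Ctx.fill {α V : Type} : Ctx α V → SPF α V → SPF α V
  | Ctx.hole, F => F
  | Ctx.andL C B, F => SPF.and (C.fill F) B
  | Ctx.andR A C, F => SPF.and A (C.fill F)
  | Ctx.dia a C, F => SPF.dia a (C.fill F)

/-- Deep inference rules (before placing in a context).  `useTop` governs
whether the `⊤`-rule `A ⟹ ⊤` is available. -/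
inductive DIRule {α V : Type} (Ax : Set (SPF α V × SPF α V)) (useTop : Bool) :
    SPF α V → SPF α V → Prop
  | dup (A) : DIRule Ax useTop A (SPF.and A A)
  | andE1 (A B) : DIRule Ax useTop (SPF.and A B) A
  | andE2 (A B) : DIRule Ax useTop (SPF.and A B) B
  | top (A) : useTop = true → DIRule Ax useTop A SPF.top
  | ax {A B} : (A, B) ∈ Ax → DIRule Ax useTop A B

/-- One deep-inference step: a rule applied within a context. -/
def DStep {α V : Type} (Ax : Set (SPF α V × SPF α V)) (useTop : Bool)
    (A B : SPF α V) : Prop :=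
  ∃ (C : Ctx α V) (F G : SPF α V), DIRule Ax useTop F G ∧ A = C.fill F ∧ B = C.fill G

/-- Derivability in the deep inference system: `B` derivable from `A`. -/
def Deriv {α V : Type} (Ax : Set (SPF α V × SPF α V)) (useTop : Bool) :
    SPF α V → SPF α V → Prop :=
  Relation.ReflTransGen (DStep Ax useTop)

/-- One rewriting step of a semi-Thue system `R`. -/
def RStep {α : Type} (R : Set (List α × List α)) (w₁ w₂ : List α) : Prop :=
  ∃ X U V Y, (U, V) ∈ R ∧ w₁ = X ++ U ++ Y ∧ w₂ = X ++ V ++ Y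

/-- `A ↠_R B`: the rewriting relation of a semi-Thue system. -/
def Rewrites {α : Type} (R : Set (List α × List α)) : List α → List α → Prop :=
  Relation.ReflTransGen (RStep R)

/-- Axioms of the logic `L_R` of a word rewriting system `R`:
all substitution instances `UC ⊢ VC` of the axioms `Up ⊢ Vp`, for rules `U ↦ V` of `R`. -/
def DAx {α V : Type} (R : Set (List α × List α)) : Set (SPF α V × SPF α V) :=
  {x | ∃ (U W : List α) (C : SPF α V), (U, W) ∈ R ∧ x = (wApp U C, wApp W C)}

/-- Closure of a set of sequents under substitution (axiom schemata). -/
def substClosure {α V : Type} (S : Set (SPF α V × SPF α V)) :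
    Set (SPF α V × SPF α V) :=
  {x | ∃ (A B : SPF α V) (σ : V → SPF α V), (A, B) ∈ S ∧ x = (A.subst σ, B.subst σ)}

/-- An (injective) Gödel numbering of strictly positive formulas over `Σ = Bool`. -/
def encSPF : SPF Bool ℕ → ℕ
  | SPF.var v => Nat.pair 0 v
  | SPF.top => Nat.pair 1 0
  | SPF.and A B => Nat.pair 2 (Nat.pair (encSPF A) (encSPF B))
  | SPF.dia a A => Nat.pair 3 (Nat.pair (cond a 1 0) (encSPF A))

set_option linter.unusedSimpArgs false

inductive TT : Type
  | leaf : TT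
  | node : TT → TT → TT

inductive Pat : Type
  | var : ℕ → Pat
  | leaf : Pat
  | node : Pat → Pat → Pat

namespace Pat

def inst (τ : ℕ → TT) : Pat → TT
  | var v => τ v
  | leaf => TT.leaf
  | node P Q => TT.node (P.inst τ) (Q.inst τ)

def vars : Pat → List ℕ
  | var v => [v]
  | leaf => []
  | node P Q => P.vars ++ Q.vars

end Pat

def MM : ℕ → SPF Bool ℕ → SPF Bool ℕ
  | 0, A => SPF.dia false A
  | i+1, A => SPF.dia true (MM i A)

def pform (σ : ℕ → SPF Bool ℕ) : Pat → SPF Bool ℕ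
  | Pat.var v => σ v
  | Pat.leaf => MM 2 SPF.top
  | Pat.node P Q => SPF.and (MM 0 (pform σ P)) (MM 1 (pform σ Q))

def tform : TT → SPF Bool ℕ
  | TT.leaf => MM 2 SPF.top
  | TT.node P Q => SPF.and (MM 0 (tform P)) (MM 1 (tform Q))

theorem MM_subst (σ : ℕ → SPF Bool ℕ) (i : ℕ) (A : SPF Bool ℕ) :
    (MM i A).subst σ = MM i (A.subst σ) := by
  induction i with
  | zero => rfl
  | succ i ih => simp [MM, SPF.subst, ih]

theorem pform_subst (σ : ℕ → SPF Bool ℕ) (P : Pat) :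
    (pform SPF.var P).subst σ = pform σ P := by
  induction P with
  | var v => rfl
  | leaf => rfl
  | node P Q ihP ihQ => simp [pform, SPF.subst, MM_subst, ihP, ihQ]

theorem pform_tform (τ : ℕ → TT) (P : Pat) :
    pform (fun v => tform (τ v)) P = tform (P.inst τ) := by
  induction P with
  | var v => rfl
  | leaf => rfl
  | node P Q ihP ihQ => simp [pform, tform, Pat.inst, ihP, ihQ]

def TStep (rs : List (Pat × Pat)) (t s : TT) : Prop :=
  ∃ r ∈ rs, ∃ τ : ℕ → TT, t = r.1.inst τ ∧ s = r.2.inst τ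

def TReach (rs : List (Pat × Pat)) : TT → TT → Prop := Relation.ReflTransGen (TStep rs)

def axS (rs : List (Pat × Pat)) : Finset (SPF Bool ℕ × SPF Bool ℕ) :=
  (rs.map (fun r => (MM 3 (pform SPF.var r.1), MM 3 (pform SPF.var r.2)))).toFinset

theorem der_of_reach (rs : List (Pat × Pat)) {t s : TT} (h : TReach rs t s) :
    Der (substClosure ↑(axS rs)) (MM 3 (tform t)) (MM 3 (tform s)) := by
  induction h with
  | refl => exact Der.id _
  | tail _ h ih =>
    refine Der.cut ih ?_
    obtain ⟨r, hr, τ, rfl, rfl⟩ := h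
    refine Der.ax ⟨MM 3 (pform SPF.var r.1), MM 3 (pform SPF.var r.2),
      (fun v => tform (τ v)), ?_, ?_⟩
    · simp only [axS, List.coe_toFinset, List.mem_map, Set.mem_ofPred_eq]
      exact ⟨r, hr, rfl⟩
    · simp [MM_subst, pform_subst, pform_tform]

inductive Base : Type
  | conf : TT → Base
  | dat : TT → Base

inductive BRel (rs : List (Pat × Pat)) : ℕ → Base → Base → Prop
  | l (a b) : BRel rs 0 (Base.dat (TT.node a b)) (Base.dat a)
  | r (a b) : BRel rs 1 (Base.dat (TT.node a b)) (Base.dat b)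
  | lf : BRel rs 2 (Base.dat TT.leaf) (Base.dat TT.leaf)
  | c (t s) : TReach rs t s → BRel rs 3 (Base.conf t) (Base.dat s)

def sat (rs : List (Pat × Pat)) : SPF Bool ℕ → Base → ℕ → Prop
  | SPF.var _, _, _ => False
  | SPF.top, _, _ => True
  | SPF.and A B, b, i => sat rs A b i ∧ sat rs B b i
  | SPF.dia true A, b, i => sat rs A b (i+1)
  | SPF.dia false A, b, i => ∃ b', BRel rs i b b' ∧ sat rs A b' 0

theorem sat_MM (rs) (i : ℕ) (A) (b : Base) (j : ℕ) :
    sat rs (MM i A) b j ↔ ∃ b', BRel rs (i+j) b b' ∧ sat rs A b' 0 := by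
  induction i generalizing j with
  | zero => simp [MM, sat]
  | succ i ih => 
    simp only [MM, sat, ih]
    rw [show i + (j+1) = i + 1 + j by omega]

theorem sat_node (rs) (A B) (t : TT) :
    sat rs (SPF.and (MM 0 A) (MM 1 B)) (Base.dat t) 0 ↔
      ∃ a b, t = TT.node a b ∧ sat rs A (Base.dat a) 0 ∧ sat rs B (Base.dat b) 0 := by
  simp only [sat, sat_MM]
  constructor
  · rintro ⟨⟨_, h1, h2⟩, ⟨_, h3, h4⟩⟩
    cases h1
    cases h3
    exact ⟨_, _, rfl, h2, h4⟩
  · rintro ⟨a, b, rfl, h1, h2⟩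
    exact ⟨⟨_, BRel.l a b, h1⟩, ⟨_, BRel.r a b, h2⟩⟩

theorem sat_leaf (rs) (t : TT) :
    sat rs (MM 2 SPF.top) (Base.dat t) 0 ↔ t = TT.leaf := by
  simp only [sat, sat_MM]
  constructor
  · rintro ⟨_, h1, _⟩
    cases h1
    rfl
  · rintro rfl
    exact ⟨_, BRel.lf, trivial⟩

theorem sat_tform (rs) (s t : TT) : sat rs (tform s) (Base.dat t) 0 ↔ t = s := by
  induction s generalizing t with
  | leaf => exact sat_leaf rs t
  | node a b iha ihb =>
    rw [tform, sat_node]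
    constructor
    · rintro ⟨x, y, rfl, h1, h2⟩
      rw [(iha _).1 h1, (ihb _).1 h2]
    · rintro rfl
      exact ⟨a, b, rfl, (iha _).2 rfl, (ihb _).2 rfl⟩

theorem sat_conf (rs) (A) (b : Base) (j : ℕ) :
    sat rs (MM 3 A) b j ↔ j = 0 ∧ ∃ t s, b = Base.conf t ∧ TReach rs t s ∧
      sat rs A (Base.dat s) 0 := by
  rw [sat_MM]
  constructor
  · rintro ⟨b', h1, h2⟩
    generalize hk : 3 + j = k at h1
    cases h1 with
    | l => omega
    | r => omega
    | lf => omega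
    | c t s h => exact ⟨by omega, t, s, rfl, h, h2⟩
  · rintro ⟨rfl, t, s, rfl, h, h2⟩
    exact ⟨_, BRel.c t s h, h2⟩

theorem sat_inst (rs) (σ : ℕ → SPF Bool ℕ) (τ : ℕ → TT) (P : Pat)
    (h : ∀ v ∈ P.vars, sat rs (σ v) (Base.dat (τ v)) 0) :
    sat rs (pform σ P) (Base.dat (P.inst τ)) 0 := by
  induction P with
  | var v => exact h v (by simp [Pat.vars])
  | leaf => exact (sat_leaf rs _).2 rfl
  | node P Q ihP ihQ =>
    rw [pform, sat_node]
    exact ⟨_, _, rfl, ihP fun v hv => h v (by simp [Pat.vars, hv]),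
      ihQ fun v hv => h v (by simp [Pat.vars, hv])⟩

theorem inst_congr (τ τ' : ℕ → TT) (P : Pat) (h : ∀ v ∈ P.vars, τ v = τ' v) :
    P.inst τ = P.inst τ' := by
  induction P with
  | var v => exact h v (by simp [Pat.vars])
  | leaf => rfl
  | node P Q ihP ihQ =>
    rw [Pat.inst, Pat.inst, ihP fun v hv => h v (by simp [Pat.vars, hv]),
      ihQ fun v hv => h v (by simp [Pat.vars, hv])]

theorem sat_match (rs) (σ : ℕ → SPF Bool ℕ) (P : Pat) (hP : P.vars.Nodup) (t : TT)
    (h : sat rs (pform σ P) (Base.dat t) 0) :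
    ∃ τ, t = P.inst τ ∧ ∀ v ∈ P.vars, sat rs (σ v) (Base.dat (τ v)) 0 := by
  induction P generalizing t with
  | var v => exact ⟨fun _ => t, rfl, by simpa [Pat.vars, pform] using h⟩
  | leaf => exact ⟨fun _ => t, (sat_leaf rs _).1 h, by simp [Pat.vars]⟩
  | node P Q ihP ihQ =>
    rw [pform, sat_node] at h
    obtain ⟨a, b, rfl, h1, h2⟩ := h
    rw [Pat.vars, List.nodup_append] at hP
    obtain ⟨hp, hq, hd⟩ := hP
    obtain ⟨τ1, rfl, k1⟩ := ihP hp a h1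
    obtain ⟨τ2, rfl, k2⟩ := ihQ hq b h2
    have e1 : ∀ v ∈ P.vars, τ1 v = (if v ∈ P.vars then τ1 v else τ2 v) := by
      intro v hv
      simp [hv]
    have e2 : ∀ v ∈ Q.vars, τ2 v = (if v ∈ P.vars then τ1 v else τ2 v) := by
      intro v hv
      have : v ∉ P.vars := fun h => hd v h v hv rfl
      simp [this]
    refine ⟨fun v => if v ∈ P.vars then τ1 v else τ2 v, ?_, ?_⟩
    · rw [Pat.inst, inst_congr _ _ P e1, inst_congr _ _ Q e2]
    · intro v hv
      rw [Pat.vars, List.mem_append] at hv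
      rcases hv with hv | hv
      · show sat rs (σ v) (Base.dat (if v ∈ P.vars then τ1 v else τ2 v)) 0
        rw [← e1 v hv]; exact k1 v hv
      · show sat rs (σ v) (Base.dat (if v ∈ P.vars then τ1 v else τ2 v)) 0
        rw [← e2 v hv]; exact k2 v hv

def RulesOK (rs : List (Pat × Pat)) : Prop :=
  ∀ r ∈ rs, r.1.vars.Nodup ∧ ∀ v ∈ r.2.vars, v ∈ r.1.vars

theorem sat_der (rs) (ok : RulesOK rs) {A B} (h : Der (substClosure ↑(axS rs)) A B) :
    ∀ b i, sat rs A b i → sat rs B b i := by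
  induction h with
  | id => exact fun _ _ h => h
  | top => exact fun _ _ _ => trivial
  | cut _ _ h1 h2 => exact fun b i h => h2 b i (h1 b i h)
  | andE1 => exact fun _ _ h => h.1
  | andE2 => exact fun _ _ h => h.2
  | andI _ _ h1 h2 => exact fun b i h => ⟨h1 b i h, h2 b i h⟩
  | mono a _ ih =>
    intro b i h
    cases a with
    | true => exact ih b (i+1) h
    | false =>
      obtain ⟨b', h1, h2⟩ := h
      exact ⟨b', h1, ih _ _ h2⟩
  | ax h =>
    obtain ⟨A, B, σ, h, e⟩ := h
    simp only [axS, List.coe_toFinset, List.mem_map, Set.mem_ofPred_eq] at h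
    obtain ⟨r, hr, e'⟩ := h
    simp only [Prod.mk.injEq] at e e'
    obtain ⟨rfl, rfl⟩ := e'
    obtain ⟨rfl, rfl⟩ := e
    intro b i
    rw [MM_subst, MM_subst, pform_subst, pform_subst, sat_conf, sat_conf]
    rintro ⟨rfl, t, s, rfl, hts, hs⟩
    obtain ⟨τ, rfl, hτ⟩ := sat_match rs σ r.1 (ok r hr).1 s hs
    exact ⟨rfl, t, r.2.inst τ, rfl, hts.tail ⟨r, hr, τ, rfl, rfl⟩,
      sat_inst rs σ τ r.2 fun v hv => hτ v ((ok r hr).2 v hv)⟩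

theorem der_iff (rs) (ok : RulesOK rs) (t s : TT) :
    Der (substClosure ↑(axS rs)) (MM 3 (tform t)) (MM 3 (tform s)) ↔ TReach rs t s := by
  refine ⟨fun h => ?_, der_of_reach rs⟩
  have := sat_der rs ok h (Base.conf t) 0
    ((sat_conf _ _ _ _).2 ⟨rfl, t, t, rfl, Relation.ReflTransGen.refl, (sat_tform _ _ _).2 rfl⟩)
  obtain ⟨_, t', s', e, h1, h2⟩ := (sat_conf _ _ _ _).1 this
  cases e
  rw [sat_tform] at h2
  exact h2 ▸ h1

def tagT : ℕ → TT
  | 0 => TT.leaf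
  | n+1 => TT.node TT.leaf (tagT n)

def tagP : ℕ → Pat
  | 0 => Pat.leaf
  | n+1 => Pat.node Pat.leaf (tagP n)

def listT : List ℕ → TT
  | [] => TT.leaf
  | a :: l => TT.node (tagT a) (listT l)

def codeT : Turing.ToPartrec.Code → TT
  | .zero' => TT.node (tagT 0) TT.leaf
  | .succ => TT.node (tagT 1) TT.leaf
  | .tail => TT.node (tagT 2) TT.leaf
  | .cons f g => TT.node (tagT 3) (TT.node (codeT f) (codeT g))
  | .comp f g => TT.node (tagT 4) (TT.node (codeT f) (codeT g))
  | .case f g => TT.node (tagT 5) (TT.node (codeT f) (codeT g))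
  | .fix f => TT.node (tagT 6) (codeT f)

def contT : Turing.ToPartrec.Cont → TT
  | .halt => TT.node (tagT 0) TT.leaf
  | .cons₁ f v k => TT.node (tagT 1) (TT.node (codeT f) (TT.node (listT v) (contT k)))
  | .cons₂ v k => TT.node (tagT 2) (TT.node (listT v) (contT k))
  | .comp f k => TT.node (tagT 3) (TT.node (codeT f) (contT k))
  | .fix f k => TT.node (tagT 4) (TT.node (codeT f) (contT k))

def evT (c k v : TT) : TT := TT.node TT.leaf (TT.node c (TT.node k v))
def rtT (k v : TT) : TT := TT.node (TT.node TT.leaf TT.leaf) (TT.node k v)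
def evP (c k v : Pat) : Pat := Pat.node Pat.leaf (Pat.node c (Pat.node k v))
def rtP (k v : Pat) : Pat := Pat.node (Pat.node Pat.leaf Pat.leaf) (Pat.node k v)

open Pat in
/-- Variables: 0 is the continuation, 1 and 2 are subcodes, 3, 4, 5 are data. -/
def theRules : List (Pat × Pat) :=
  [ (evP (node (tagP 0) leaf) (var 0) (var 3), rtP (var 0) (node leaf (var 3))),
    (evP (node (tagP 1) leaf) (var 0) leaf, rtP (var 0) (node (node leaf leaf) leaf)),
    (evP (node (tagP 1) leaf) (var 0) (node (var 3) (var 4)),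
      rtP (var 0) (node (node leaf (var 3)) leaf)),
    (evP (node (tagP 2) leaf) (var 0) leaf, rtP (var 0) leaf),
    (evP (node (tagP 2) leaf) (var 0) (node (var 3) (var 4)), rtP (var 0) (var 4)),
    (evP (node (tagP 3) (node (var 1) (var 2))) (var 0) (var 3),
      evP (var 1) (node (tagP 1) (node (var 2) (node (var 3) (var 0)))) (var 3)),
    (evP (node (tagP 4) (node (var 1) (var 2))) (var 0) (var 3),
      evP (var 2) (node (tagP 3) (node (var 1) (var 0))) (var 3)),
    (evP (node (tagP 5) (node (var 1) (var 2))) (var 0) leaf, evP (var 1) (var 0) leaf),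
    (evP (node (tagP 5) (node (var 1) (var 2))) (var 0) (node leaf (var 3)),
      evP (var 1) (var 0) (var 3)),
    (evP (node (tagP 5) (node (var 1) (var 2))) (var 0) (node (node leaf (var 4)) (var 3)),
      evP (var 2) (var 0) (node (var 4) (var 3))),
    (evP (node (tagP 6) (var 1)) (var 0) (var 3),
      evP (var 1) (node (tagP 4) (node (var 1) (var 0))) (var 3)),
    (rtP (node (tagP 0) leaf) (var 3), leaf),
    (rtP (node (tagP 1) (node (var 1) (node (var 3) (var 0)))) (var 4),
      evP (var 1) (node (tagP 2) (node (var 4) (var 0))) (var 3)),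
    (rtP (node (tagP 2) (node leaf (var 0))) (var 4), rtP (var 0) (node leaf (var 4))),
    (rtP (node (tagP 2) (node (node (var 3) (var 5)) (var 0))) (var 4),
      rtP (var 0) (node (var 3) (var 4))),
    (rtP (node (tagP 3) (node (var 1) (var 0))) (var 4), evP (var 1) (var 0) (var 4)),
    (rtP (node (tagP 4) (node (var 1) (var 0))) leaf, rtP (var 0) leaf),
    (rtP (node (tagP 4) (node (var 1) (var 0))) (node leaf (var 4)), rtP (var 0) (var 4)),
    (rtP (node (tagP 4) (node (var 1) (var 0))) (node (node leaf (var 3)) (var 4)),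
      evP (var 1) (node (tagP 4) (node (var 1) (var 0))) (var 4)) ]

theorem theRules_ok : RulesOK theRules := by
  simp [RulesOK, theRules, evP, rtP, tagP, Pat.vars]

/-- assignment from a list -/
def asg (a b c d e f : TT) : ℕ → TT
  | 0 => a
  | 1 => b
  | 2 => c
  | 3 => d
  | 4 => e
  | _ => f

def TR (t s : TT) : Prop := TReach theRules t s

theorem TR.trans {a b c : TT} (h : TR a b) (h' : TR b c) : TR a c :=
  Relation.ReflTransGen.trans h h'

theorem TR.rule (i : ℕ) (hi : i < theRules.length) (a b c d e f : TT) :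
    TR ((theRules[i]).1.inst (asg a b c d e f)) ((theRules[i]).2.inst (asg a b c d e f)) :=
  Relation.ReflTransGen.single ⟨_, List.getElem_mem hi, _, rfl, rfl⟩

open Turing.ToPartrec

def cfgT : Cfg → TT
  | .halt _ => TT.leaf
  | .ret k v => rtT (contT k) (listT v)

theorem TR_normal (c : Code) : ∀ (k : Cont) (v : List ℕ),
    TR (evT (codeT c) (contT k) (listT v)) (cfgT (stepNormal c k v)) := by
  have L : TT := TT.leaf
  induction c with
  | zero' => intro k v; exact TR.rule 0 (by decide) (contT k) L L (listT v) L L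
  | succ =>
    intro k v
    cases v with
    | nil => exact TR.rule 1 (by decide) (contT k) L L L L L
    | cons a v => exact TR.rule 2 (by decide) (contT k) L L (tagT a) (listT v) L
  | tail =>
    intro k v
    cases v with
    | nil => exact TR.rule 3 (by decide) (contT k) L L L L L
    | cons a v => exact TR.rule 4 (by decide) (contT k) L L (tagT a) (listT v) L
  | cons f g ihf ihg =>
    intro k v
    refine TR.trans ?_ (ihf _ _)
    exact TR.rule 5 (by decide) (contT k) (codeT f) (codeT g) (listT v) L L
  | comp f g ihf ihg =>
    intro k v
    refine TR.trans ?_ (ihg _ _)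
    exact TR.rule 6 (by decide) (contT k) (codeT f) (codeT g) (listT v) L L
  | case f g ihf ihg =>
    intro k v
    rcases v with _ | ⟨_ | a, v⟩
    · refine TR.trans ?_ (ihf k [])
      exact TR.rule 7 (by decide) (contT k) (codeT f) (codeT g) L L L
    · refine TR.trans ?_ (ihf k v)
      exact TR.rule 8 (by decide) (contT k) (codeT f) (codeT g) (listT v) L L
    · refine TR.trans ?_ (ihg k (a :: v))
      exact TR.rule 9 (by decide) (contT k) (codeT f) (codeT g) (listT v) (tagT a) L
  | fix f ihf =>
    intro k v
    refine TR.trans ?_ (ihf _ _)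
    exact TR.rule 10 (by decide) (contT k) (codeT f) L (listT v) L L

theorem TR_ret (k : Cont) : ∀ (v : List ℕ),
    TR (rtT (contT k) (listT v)) (cfgT (stepRet k v)) := by
  have L : TT := TT.leaf
  induction k with
  | halt => intro v; exact TR.rule 11 (by decide) L L L (listT v) L L
  | cons₁ f as k ih =>
    intro v
    refine TR.trans ?_ (TR_normal _ _ _)
    exact TR.rule 12 (by decide) (contT k) (codeT f) L (listT as) (listT v) L
  | cons₂ ns k ih =>
    intro v
    cases ns with
    | nil =>
      refine TR.trans ?_ (ih _)
      exact TR.rule 13 (by decide) (contT k) L L L (listT v) L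
    | cons a ns =>
      refine TR.trans ?_ (ih _)
      exact TR.rule 14 (by decide) (contT k) L L (tagT a) (listT v) (listT ns)
  | comp f k ih =>
    intro v
    refine TR.trans ?_ (TR_normal _ _ _)
    exact TR.rule 15 (by decide) (contT k) (codeT f) L L (listT v) L
  | fix f k ih =>
    intro v
    rcases v with _ | ⟨_ | a, v⟩
    · refine TR.trans ?_ (ih _)
      exact TR.rule 16 (by decide) (contT k) (codeT f) L L L L
    · refine TR.trans ?_ (ih _)
      exact TR.rule 17 (by decide) (contT k) (codeT f) L L (listT v) L
    · refine TR.trans ?_ (TR_normal _ _ _)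
      exact TR.rule 18 (by decide) (contT k) (codeT f) L (tagT a) (listT v) L

theorem TR_of_dom (x : Cfg) (h : (StateTransition.eval step x).Dom) : TR (cfgT x) TT.leaf := by
  obtain ⟨b, hb⟩ := Part.dom_iff_mem.1 h
  obtain ⟨h1, h2⟩ := StateTransition.mem_eval.1 hb
  clear hb h
  induction h1 using Relation.ReflTransGen.head_induction_on with
  | refl =>
    cases b with
    | halt => exact Relation.ReflTransGen.refl
    | ret => simp [step] at h2
  | head hs _ ih =>
    rename_i x y _
    cases x with
    | halt => simp [step] at hs
    | ret k v =>
      simp [step] at hs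
      subst hs
      exact (TR_ret k v).trans ih

theorem eval_ret (k v) : StateTransition.eval step (Cfg.ret k v) =
    StateTransition.eval step (stepRet k v) :=
  StateTransition.reaches_eval (Relation.ReflTransGen.single rfl)

theorem dom_of_TR {t : TT} (h : TR t TT.leaf) :
    (∀ c k v, t = evT (codeT c) (contT k) (listT v) →
      (StateTransition.eval step (stepNormal c k v)).Dom) ∧
    (∀ k v, t = rtT (contT k) (listT v) → (StateTransition.eval step (stepRet k v)).Dom) := by
  induction h using Relation.ReflTransGen.head_induction_on with
  | refl => exact ⟨by simp [evT], by simp [rtT]⟩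
  | head hs _ ih =>
    rename_i x y _
    obtain ⟨ih1, ih2⟩ := ih
    constructor
    · rintro c k v rfl
      cases c with
      | zero' =>
        simp [TStep, theRules, evT, rtT, codeT, contT, tagP, tagT, evP, rtP, Pat.inst, listT] at hs
        obtain ⟨τ, hs⟩ := hs
        rw [show stepNormal _ k _ = Cfg.ret k (0 :: v) from rfl, eval_ret]; exact ih2 (k) ((0 :: v)) (by simp_all [evT, rtT, codeT, contT, tagT, listT])
      | succ =>
        rcases v with _ | ⟨a, v⟩
        · simp [TStep, theRules, evT, rtT, codeT, contT, tagP, tagT, evP, rtP, Pat.inst, listT] at hs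
          obtain ⟨τ, hs⟩ := hs
          rw [show stepNormal _ k _ = Cfg.ret k [1] from rfl, eval_ret]; exact ih2 (k) ([1]) (by simp_all [evT, rtT, codeT, contT, tagT, listT])
        · simp [TStep, theRules, evT, rtT, codeT, contT, tagP, tagT, evP, rtP, Pat.inst, listT] at hs
          obtain ⟨τ, hs⟩ := hs
          rw [show stepNormal _ k _ = Cfg.ret k [a+1] from rfl, eval_ret]; exact ih2 (k) ([a+1]) (by simp_all [evT, rtT, codeT, contT, tagT, listT])
      | tail =>
        rcases v with _ | ⟨a, v⟩
        · simp [TStep, theRules, evT, rtT, codeT, contT, tagP, tagT, evP, rtP, Pat.inst, listT] at hs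
          obtain ⟨τ, hs⟩ := hs
          rw [show stepNormal _ k _ = Cfg.ret k [] from rfl, eval_ret]; exact ih2 (k) ([]) (by simp_all [evT, rtT, codeT, contT, tagT, listT])
        · simp [TStep, theRules, evT, rtT, codeT, contT, tagP, tagT, evP, rtP, Pat.inst, listT] at hs
          obtain ⟨τ, hs⟩ := hs
          rw [show stepNormal _ k _ = Cfg.ret k v from rfl, eval_ret]; exact ih2 (k) (v) (by simp_all [evT, rtT, codeT, contT, tagT, listT])
      | cons f g =>
        simp [TStep, theRules, evT, rtT, codeT, contT, tagP, tagT, evP, rtP, Pat.inst, listT] at hs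
        obtain ⟨τ, hs⟩ := hs
        exact ih1 (f) (Cont.cons₁ g v k) (v) (by simp_all [evT, rtT, codeT, contT, tagT, listT])
      | comp f g =>
        simp [TStep, theRules, evT, rtT, codeT, contT, tagP, tagT, evP, rtP, Pat.inst, listT] at hs
        obtain ⟨τ, hs⟩ := hs
        exact ih1 (g) (Cont.comp f k) (v) (by simp_all [evT, rtT, codeT, contT, tagT, listT])
      | case f g =>
        rcases v with _ | ⟨_ | a, v⟩
        · simp [TStep, theRules, evT, rtT, codeT, contT, tagP, tagT, evP, rtP, Pat.inst, listT] at hs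
          obtain ⟨τ, hs⟩ := hs
          exact ih1 (f) (k) ([]) (by simp_all [evT, rtT, codeT, contT, tagT, listT])
        · simp [TStep, theRules, evT, rtT, codeT, contT, tagP, tagT, evP, rtP, Pat.inst, listT] at hs
          obtain ⟨τ, hs⟩ := hs
          exact ih1 (f) (k) (v) (by simp_all [evT, rtT, codeT, contT, tagT, listT])
        · simp [TStep, theRules, evT, rtT, codeT, contT, tagP, tagT, evP, rtP, Pat.inst, listT] at hs
          obtain ⟨τ, hs⟩ := hs
          exact ih1 (g) (k) (a :: v) (by simp_all [evT, rtT, codeT, contT, tagT, listT])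
      | fix f =>
        simp [TStep, theRules, evT, rtT, codeT, contT, tagP, tagT, evP, rtP, Pat.inst, listT] at hs
        obtain ⟨τ, hs⟩ := hs
        exact ih1 (f) (Cont.fix f k) (v) (by simp_all [evT, rtT, codeT, contT, tagT, listT])
    · rintro k v rfl
      cases k with
      | halt => exact Part.dom_iff_mem.2 ⟨Cfg.halt v, StateTransition.mem_eval.2 ⟨Relation.ReflTransGen.refl, rfl⟩⟩
      | cons₁ f as k =>
        simp [TStep, theRules, evT, rtT, codeT, contT, tagP, tagT, evP, rtP, Pat.inst, listT] at hs
        obtain ⟨τ, hs⟩ := hs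
        exact ih1 (f) (Cont.cons₂ v k) (as) (by simp_all [evT, rtT, codeT, contT, tagT, listT])
      | cons₂ ns k =>
        rcases ns with _ | ⟨a, ns⟩
        · simp [TStep, theRules, evT, rtT, codeT, contT, tagP, tagT, evP, rtP, Pat.inst, listT] at hs
          obtain ⟨τ, hs⟩ := hs
          exact ih2 (k) (0 :: v) (by simp_all [evT, rtT, codeT, contT, tagT, listT])
        · simp [TStep, theRules, evT, rtT, codeT, contT, tagP, tagT, evP, rtP, Pat.inst, listT] at hs
          obtain ⟨τ, hs⟩ := hs
          exact ih2 (k) (a :: v) (by simp_all [evT, rtT, codeT, contT, tagT, listT])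
      | comp f k =>
        simp [TStep, theRules, evT, rtT, codeT, contT, tagP, tagT, evP, rtP, Pat.inst, listT] at hs
        obtain ⟨τ, hs⟩ := hs
        exact ih1 (f) (k) (v) (by simp_all [evT, rtT, codeT, contT, tagT, listT])
      | fix f k =>
        rcases v with _ | ⟨_ | a, v⟩
        · simp [TStep, theRules, evT, rtT, codeT, contT, tagP, tagT, evP, rtP, Pat.inst, listT] at hs
          obtain ⟨τ, hs⟩ := hs
          exact ih2 (k) ([]) (by simp_all [evT, rtT, codeT, contT, tagT, listT])
        · simp [TStep, theRules, evT, rtT, codeT, contT, tagP, tagT, evP, rtP, Pat.inst, listT] at hs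
          obtain ⟨τ, hs⟩ := hs
          exact ih2 (k) (v) (by simp_all [evT, rtT, codeT, contT, tagT, listT])
        · simp [TStep, theRules, evT, rtT, codeT, contT, tagP, tagT, evP, rtP, Pat.inst, listT] at hs
          obtain ⟨τ, hs⟩ := hs
          exact ih1 (f) (Cont.fix f k) (v) (by simp_all [evT, rtT, codeT, contT, tagT, listT])

theorem TR_iff (c : Code) (v : List ℕ) :
    TR (evT (codeT c) (contT Cont.halt) (listT v)) TT.leaf ↔ (c.eval v).Dom := by
  have e : (StateTransition.eval step (stepNormal c Cont.halt v)).Dom ↔ (c.eval v).Dom := by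
    rw [stepNormal_eval]; rfl
  rw [← e]
  exact ⟨fun h => (dom_of_TR h).1 c _ v rfl,
    fun h => (TR_normal c _ v).trans (TR_of_dom _ h)⟩

theorem encSPF_inj : ∀ A B : SPF Bool ℕ, encSPF A = encSPF B → A = B := by
  intro A
  induction A with
  | var v => intro B h; cases B <;> simp_all [encSPF]
  | top => intro B h; cases B <;> simp_all [encSPF]
  | and A1 A2 ih1 ih2 =>
    intro B h
    cases B <;> simp [encSPF] at h
    rw [ih1 _ h.1, ih2 _ h.2]
  | dia a A ih =>
    intro B h
    cases B with
    | dia b B =>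
      simp [encSPF] at h
      rw [ih _ h.2]
      have := h.1
      revert this
      cases a <;> cases b <;> simp
    | _ => simp [encSPF] at h

/-- numeric version of `MM` -/
def numM : ℕ → ℕ → ℕ
  | 0, x => Nat.pair 3 (Nat.pair 0 x)
  | i+1, x => Nat.pair 3 (Nat.pair 1 (numM i x))

theorem encSPF_MM (i A) : encSPF (MM i A) = numM i (encSPF A) := by
  induction i with
  | zero => rfl
  | succ i ih => simp [MM, encSPF, numM, ih]

theorem numM_primrec (i : ℕ) : Primrec (numM i) := by
  induction i with
  | zero =>
    exact Primrec₂.natPair.comp (Primrec.const 3)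
      (Primrec₂.natPair.comp (Primrec.const 0) Primrec.id)
  | succ i ih =>
    exact Primrec₂.natPair.comp (Primrec.const 3)
      (Primrec₂.natPair.comp (Primrec.const 1) ih)

def numN (x y : ℕ) : ℕ := Nat.pair 2 (Nat.pair (numM 0 x) (numM 1 y))

theorem numN_primrec : Primrec₂ numN :=
  Primrec₂.natPair.comp (Primrec.const 2)
    (Primrec₂.natPair.comp ((numM_primrec 0).comp Primrec.fst) ((numM_primrec 1).comp Primrec.snd))

theorem enc_node (a b : TT) :
    encSPF (tform (TT.node a b)) = numN (encSPF (tform a)) (encSPF (tform b)) := by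
  simp [tform, encSPF, encSPF_MM, numN]

theorem enc_tag_primrec : Primrec fun n => encSPF (tform (tagT n)) := by
  have h : Primrec fun n : ℕ => (Nat.rec (encSPF (tform TT.leaf))
      (fun _ y => numN (encSPF (tform TT.leaf)) y) n : ℕ) :=
    Primrec.nat_rec₁ _ (numN_primrec.comp (Primrec.const _) Primrec.snd)
  refine h.of_eq fun n => ?_
  induction n with
  | zero => rfl
  | succ n ih => rw [tagT, enc_node, ← ih]

theorem enc_start_primrec (c : Code) (k : Cont) :
    Primrec fun n => encSPF (MM 3 (tform (evT (codeT c) (contT k) (listT [n])))) := by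
  have N : ∀ {f g : ℕ → TT}, Primrec (fun n => encSPF (tform (f n))) →
      Primrec (fun n => encSPF (tform (g n))) →
      Primrec (fun n => encSPF (tform (TT.node (f n) (g n)))) := by
    intro f g hf hg
    simp only [enc_node]
    exact numN_primrec.comp hf hg
  simp only [encSPF_MM]
  refine (numM_primrec 3).comp ?_
  exact N (Primrec.const _) (N (Primrec.const _) (N (Primrec.const _)
    (N enc_tag_primrec (Primrec.const _))))

theorem universal_code : ∃ c : Code, ∀ d : Nat.Partrec.Code,
    (c.eval [Encodable.encode d]).Dom ↔ (d.eval 0).Dom := by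
  have hp : Partrec fun n : ℕ => Nat.Partrec.Code.eval (Denumerable.ofNat Nat.Partrec.Code n) 0 :=
    Nat.Partrec.Code.eval_part.comp (Computable.ofNat _) (Computable.const 0)
  obtain ⟨c, hc⟩ := Code.exists_code (Nat.Partrec'.part_iff₁.2 hp)
  refine ⟨c, fun d => ?_⟩
  have := hc ⟨[Encodable.encode d], rfl⟩
  simp only at this
  rw [this]
  show (Nat.Partrec.Code.eval (Denumerable.ofNat Nat.Partrec.Code (Encodable.encode d)) 0).Dom ↔ _
  rw [Denumerable.ofNat_encode]

/-- There is a finitely axiomatized normal strictly positive logic (over the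
finite signature `Bool`) whose set of provable sequents is undecidable. -/
theorem undecidable_sp_logic :
    ∃ S : Finset (SPF Bool ℕ × SPF Bool ℕ),
      ¬ ComputablePred (fun n : ℕ => ∃ A B : SPF Bool ℕ,
        n = Nat.pair (encSPF A) (encSPF B) ∧ Der (substClosure ↑S) A B) := by
  obtain ⟨c, hc⟩ := universal_code
  refine ⟨axS theRules, fun H => ComputablePred.halting_problem 0 ?_⟩
  refine ComputablePred.computable_of_manyOneReducible
    ⟨fun d : Nat.Partrec.Code => Nat.pair
      (encSPF (MM 3 (tform (evT (codeT c) (contT Cont.halt) (listT [Encodable.encode d])))))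
      (encSPF (MM 3 (tform TT.leaf))), ?_, ?_⟩ H
  · exact (Primrec₂.natPair.comp ((enc_start_primrec c Cont.halt).comp Primrec.encode)
      (Primrec.const _)).to_comp
  · intro d
    refine ((hc d).symm.trans ((TR_iff c _).symm.trans (der_iff theRules theRules_ok _ _).symm)).trans ?_
    constructor
    · intro h
      exact ⟨_, _, rfl, h⟩
    · rintro ⟨A, B, e, h⟩
      rw [Nat.pair_eq_pair] at e
      rw [← encSPF_inj _ _ e.1, ← encSPF_inj _ _ e.2] at h
      exact h
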